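/- Let (Σ,σ) be a topologically transitive countable Markov shift with the F-property, and let φ : Σ → ℝ have summable variations and Gurevich pressure P(φ) = 0. If δ_{φ,∞} < 0 (condition (CI)), then χ_per(φ) := sup{(1/n)S_nφ(x) : σ^n x = x, n ∈ ℕ} < 0 (condition (UCS)). -/

import Mathlib

open Filter Set MeasureTheory Real ENNReal

namespace CMS

/-- Points of the full sequence space over the alphabet `ℕ`. -/
abbrev Pt : Type := ℕ → ℕ

/-- The (left) shift map `σ`. -/
def shiftMap : Pt → Pt := fun x i => x (i + 1)

/-- `x` is a point of the countable Markov shift `Σ` determined by the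
transition matrix `M` (identified with a relation on the alphabet `ℕ`). -/
def isAdmissible (M : ℕ → ℕ → Prop) (x : Pt) : Prop := ∀ i, M (x i) (x (i + 1))

/-- Topological transitivity: for all states `a, b` there is `N` with
`[a] ∩ σ⁻ᴺ [b] ≠ ∅`. -/
def TopTransitive (M : ℕ → ℕ → Prop) : Prop :=
  ∀ a b : ℕ, ∃ (N : ℕ) (x : Pt), isAdmissible M x ∧ x 0 = a ∧ x N = b

/-- Birkhoff sum `S_n φ`. -/
noncomputable def birkhoff (φ : Pt → ℝ) (n : ℕ) (x : Pt) : ℝ :=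
  ∑ i ∈ Finset.range n, φ (shiftMap^[i] x)

/-- `φ` has summable variations: `∑_{k ≥ 2} var_k(φ) < ∞`, expressed via a summable
sequence dominating the `k`-th variations. -/
def SummableVariations (M : ℕ → ℕ → Prop) (φ : Pt → ℝ) : Prop :=
  ∃ V : ℕ → ℝ, Summable V ∧
    ∀ k, 2 ≤ k → ∀ x y : Pt, isAdmissible M x → isAdmissible M y →
      (∀ i < k, x i = y i) → |φ x - φ y| ≤ V k

/-- `φ` is weakly Hölder continuous: `var_k(φ) ≤ C θ^k` for all `k ≥ 2`. -/
def WeaklyHolder (M : ℕ → ℕ → Prop) (φ : Pt → ℝ) : Prop :=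
  ∃ C θ : ℝ, 0 < C ∧ 0 < θ ∧ θ < 1 ∧
    ∀ k, 2 ≤ k → ∀ x y : Pt, isAdmissible M x → isAdmissible M y →
      (∀ i < k, x i = y i) → |φ x - φ y| ≤ C * θ ^ k

/-- Periodic points of period `n` in the 1-cylinder `[a]`. -/
def PerSet (M : ℕ → ℕ → Prop) (a n : ℕ) : Set Pt :=
  {x | isAdmissible M x ∧ shiftMap^[n] x = x ∧ x 0 = a}

/-- Periodic points of period `n` in `[a]` whose first return time to `[a]` is `n`. -/
def PerStarSet (M : ℕ → ℕ → Prop) (a n : ℕ) : Set Pt :=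
  {x | isAdmissible M x ∧ shiftMap^[n] x = x ∧ x 0 = a ∧ ∀ k, 0 < k → k < n → x k ≠ a}

/-- The Gurevich partition function `Z_n(φ, a)`. -/
noncomputable def Zn (M : ℕ → ℕ → Prop) (φ : Pt → ℝ) (a n : ℕ) : ℝ≥0∞ :=
  ∑' x : PerSet M a n, ENNReal.ofReal (Real.exp (birkhoff φ n x.1))

/-- The first-return partition function `Z_n^*(φ, a)`. -/
noncomputable def ZnStar (M : ℕ → ℕ → Prop) (φ : Pt → ℝ) (a n : ℕ) : ℝ≥0∞ :=
  ∑' x : PerStarSet M a n, ENNReal.ofReal (Real.exp (birkhoff φ n x.1))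

/-- The Gurevich pressure at the state `a`:
`P(φ) = limsup_n (1/n) log Z_n(φ, a)`, with values in `EReal`. -/
noncomputable def pressureAt (M : ℕ → ℕ → Prop) (φ : Pt → ℝ) (a : ℕ) : EReal :=
  Filter.limsup (fun n : ℕ => ((n : ℝ)⁻¹ : EReal) * ENNReal.log (Zn M φ a n)) atTop

/-- `limsup_n (1/n) log Z_n^*(φ, a)`, with values in `EReal`. -/
noncomputable def pressureStarAt (M : ℕ → ℕ → Prop) (φ : Pt → ℝ) (a : ℕ) : EReal :=
  Filter.limsup (fun n : ℕ => ((n : ℝ)⁻¹ : EReal) * ENNReal.log (ZnStar M φ a n)) atTop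

/-- Strong positive recurrence of `φ`, relative to the common value `P` of the
Gurevich pressure: for some state `a`, `limsup_n (1/n) log Z_n^*(φ,a) < P(φ)`. -/
def SPR (M : ℕ → ℕ → Prop) (φ : Pt → ℝ) (P : ℝ) : Prop :=
  ∃ a : ℕ, pressureStarAt M φ a < (P : EReal)

/-- The `F`-property: for every state `a` and every `n ≥ 1` there are only finitely
many periodic points of period `n` in `[a]`. -/
def FProperty (M : ℕ → ℕ → Prop) : Prop :=
  ∀ a n : ℕ, 0 < n → (PerSet M a n).Finite

/-- `χ_per(φ) = sup { (1/n) S_n φ(x) : σ^n x = x, n ∈ ℕ }`, with values in `EReal`. -/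
noncomputable def chiPer (M : ℕ → ℕ → Prop) (φ : Pt → ℝ) : EReal :=
  ⨆ p : {p : Pt × ℕ // isAdmissible M p.1 ∧ 0 < p.2 ∧ shiftMap^[p.2] p.1 = p.1},
    ((birkhoff φ p.1.2 p.1.1 / (p.1.2 : ℝ) : ℝ) : EReal)

/-- `x` lies in a cylinder belonging to `B(n, M', q)`: it is admissible,
`x 0 ≤ q`, `x n ≤ q` and `#{0 ≤ k ≤ n : x k ≤ q} ≤ (n+1)/M'`. -/
def inBSet (M : ℕ → ℕ → Prop) (n M' q : ℕ) (x : Pt) : Prop :=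
  isAdmissible M x ∧ x 0 ≤ q ∧ x n ≤ q ∧
    ((((Finset.range (n + 1)).filter (fun k => x k ≤ q)).card : ℝ) ≤ (n + 1 : ℝ) / (M' : ℝ))

/-- `z_{φ,n}(M',q) = sup { (1/n) S_n φ(x) : x ∈ B for some B ∈ B(n,M',q) }`. -/
noncomputable def zPhi (M : ℕ → ℕ → Prop) (φ : Pt → ℝ) (n M' q : ℕ) : EReal :=
  ⨆ x : {x : Pt // inBSet M n M' q x}, ((birkhoff φ n x.1 / (n : ℝ) : ℝ) : EReal)

/-- The contraction at infinity
`δ_{φ,∞} = lim_{q→∞} lim_{M'→∞} limsup_{n→∞} z_{φ,n}(M',q)`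
(the inner limits exist by monotonicity, so they agree with `liminf`s). -/
noncomputable def deltaInf (M : ℕ → ℕ → Prop) (φ : Pt → ℝ) : EReal :=
  liminf (fun q : ℕ => liminf (fun M' : ℕ =>
    limsup (fun n : ℕ => zPhi M φ n M' q) atTop) atTop) atTop

/-- `z_n(M',q) = #B(n,M',q)`, the number of `(n+1)`-cylinders (i.e. admissible
words realized in `Σ`) in `B(n,M',q)`, counted in `ℝ≥0∞`. -/
noncomputable def zCount (M : ℕ → ℕ → Prop) (n M' q : ℕ) : ℝ≥0∞ :=
  ∑' _w : {w : Fin (n + 1) → ℕ //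
      (∃ x : Pt, isAdmissible M x ∧ ∀ i : Fin (n + 1), x (i : ℕ) = w i) ∧
      w 0 ≤ q ∧ w (Fin.last n) ≤ q ∧
      (((Finset.univ.filter (fun i : Fin (n + 1) => w i ≤ q)).card : ℝ) ≤ (n + 1 : ℝ) / (M' : ℝ))},
    (1 : ℝ≥0∞)

/-- The entropy at infinity
`h_∞ = lim_{q→∞} lim_{M'→∞} limsup_{n→∞} (1/n) log z_n(M',q)`. -/
noncomputable def hInfty (M : ℕ → ℕ → Prop) : EReal :=
  liminf (fun q : ℕ => liminf (fun M' : ℕ =>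
    limsup (fun n : ℕ => ((n : ℝ)⁻¹ : EReal) * ENNReal.log (zCount M n M' q)) atTop) atTop) atTop

end CMS

namespace CMS

section Splicing

lemma shiftMap_iterate_apply (n : ℕ) (x : Pt) (i : ℕ) : shiftMap^[n] x i = x (i + n) := by
  induction n generalizing x with
  | zero => rfl
  | succ n ih =>
    rw [Function.iterate_succ_apply, ih]
    simp only [shiftMap]
    congr 1

lemma isAdmissible.iterate {M : ℕ → ℕ → Prop} {x : Pt} (hx : isAdmissible M x) (n : ℕ) :
    isAdmissible M (shiftMap^[n] x) := by
  intro i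
  rw [shiftMap_iterate_apply, shiftMap_iterate_apply, Nat.add_right_comm]
  exact hx _

lemma birkhoff_add (φ : Pt → ℝ) (m n : ℕ) (x : Pt) :
    birkhoff φ (m + n) x = birkhoff φ m x + birkhoff φ n (shiftMap^[m] x) := by
  simp only [birkhoff, Finset.sum_range_add]
  congr 1
  refine Finset.sum_congr rfl fun i _ => ?_
  rw [← Function.iterate_add_apply, Nat.add_comm]

lemma iterate_mul_of_periodic {x : Pt} {n : ℕ} (h : shiftMap^[n] x = x) (k : ℕ) :
    shiftMap^[k * n] x = x := by
  rw [Nat.mul_comm, Function.iterate_mul]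
  exact Function.iterate_fixed h k

lemma birkhoff_mul_of_periodic (φ : Pt → ℝ) {x : Pt} {n : ℕ} (h : shiftMap^[n] x = x) (k : ℕ) :
    birkhoff φ (k * n) x = k * birkhoff φ n x := by
  induction k with
  | zero => simp [birkhoff]
  | succ k ih =>
    rw [Nat.succ_mul, birkhoff_add, ih, iterate_mul_of_periodic h]
    push_cast
    ring

lemma count_mul_of_periodic {x : Pt} {n : ℕ} (h : shiftMap^[n] x = x) (p : ℕ → Prop)
    [DecidablePred p] (k : ℕ) :
    Nat.count (fun i => p (x i)) (k * n) = k * Nat.count (fun i => p (x i)) n := by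
  induction k with
  | zero => simp
  | succ k ih =>
    have hx : ∀ i, x (k * n + i) = x i := fun i => by
      rw [Nat.add_comm, ← shiftMap_iterate_apply (k * n) x, iterate_mul_of_periodic h]
    rw [Nat.succ_mul, Nat.count_add, ih, Nat.succ_mul]
    simp only [hx]

/-- The first `n` symbols of `x`, followed by `y`. -/
def splice (n : ℕ) (x y : Pt) : Pt := fun i => if i < n then x i else y (i - n)

lemma splice_apply_of_le {n : ℕ} {x y : Pt} (h : x n = y 0) {i : ℕ} (hi : i ≤ n) :
    splice n x y i = x i := by
  rcases hi.lt_or_eq with hi | rfl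
  · simp [splice, hi]
  · simp [splice, h]

lemma splice_apply_add (n : ℕ) (x y : Pt) (i : ℕ) : splice n x y (n + i) = y i := by
  simp [splice]

lemma iterate_splice (n : ℕ) (x y : Pt) : shiftMap^[n] (splice n x y) = y := by
  funext i
  rw [shiftMap_iterate_apply, Nat.add_comm, splice_apply_add]

lemma isAdmissible.splice {M : ℕ → ℕ → Prop} {n : ℕ} {x y : Pt} (hx : isAdmissible M x)
    (hy : isAdmissible M y) (h : x n = y 0) : isAdmissible M (splice n x y) := by
  intro i
  rcases lt_or_ge i n with hi | hi
  · rw [splice_apply_of_le h hi.le, splice_apply_of_le h hi]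
    exact hx i
  · obtain ⟨j, rfl⟩ := Nat.exists_eq_add_of_le hi
    rw [Nat.add_assoc, splice_apply_add, splice_apply_add]
    exact hy j

/-- The periodic sequence repeating the first `n` symbols of `x`. -/
def perClosure (n : ℕ) (x : Pt) : Pt := fun i => x (i % n)

lemma perClosure_apply_of_le {n : ℕ} {x : Pt} (h : x n = x 0) {i : ℕ} (hi : i ≤ n) :
    perClosure n x i = x i := by
  rcases hi.lt_or_eq with hi | rfl
  · simp [perClosure, Nat.mod_eq_of_lt hi]
  · simp [perClosure, h]

lemma iterate_perClosure (n : ℕ) (x : Pt) :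
    shiftMap^[n] (perClosure n x) = perClosure n x := by
  funext i
  rw [shiftMap_iterate_apply]
  simp [perClosure]

lemma isAdmissible.perClosure {M : ℕ → ℕ → Prop} {n : ℕ} {x : Pt} (hx : isAdmissible M x)
    (hn : 0 < n) (h : x n = x 0) : isAdmissible M (perClosure n x) := by
  intro i
  have h1 : CMS.perClosure n x i = x (i % n) := rfl
  have h2 : CMS.perClosure n x (i + 1) = x (i % n + 1) := by
    rw [← perClosure_apply_of_le h (Nat.mod_lt i hn)]
    simp [CMS.perClosure]
  rw [h1, h2]
  exact hx _

end Splicing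

section Distortion

/-- Birkhoff sums of length `n` of two points agreeing up to time `n` differ by at most `D`. -/
def BoundedDistortion (M : ℕ → ℕ → Prop) (φ : Pt → ℝ) (D : ℝ) : Prop :=
  ∀ n : ℕ, ∀ x y : Pt, isAdmissible M x → isAdmissible M y → (∀ i ≤ n, x i = y i) →
    birkhoff φ n x ≤ birkhoff φ n y + D

lemma SummableVariations.exists_boundedDistortion {M : ℕ → ℕ → Prop} {φ : Pt → ℝ}
    (h : SummableVariations M φ) : ∃ D, BoundedDistortion M φ D := by
  obtain ⟨V, hV, hvar⟩ := h
  have hsum : Summable fun j => |V (j + 2)| := ((summable_nat_add_iff 2).2 hV).abs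
  refine ⟨∑' j, |V (j + 2)|, ?_⟩
  have key : ∀ n : ℕ, ∀ x y : Pt, isAdmissible M x → isAdmissible M y →
      (∀ i ≤ n, x i = y i) →
      birkhoff φ n x ≤ birkhoff φ n y + ∑ j ∈ Finset.range n, |V (j + 2)| := by
    intro n
    induction n with
    | zero => intros; simp [birkhoff]
    | succ n ih =>
      intro x y hx hy hxy
      have h1 := ih _ _ (hx.iterate 1) (hy.iterate 1) fun i hi => by
        rw [shiftMap_iterate_apply, shiftMap_iterate_apply]
        exact hxy _ (by omega)
      have h2 := hvar (n + 2) (by omega) x y hx hy fun i hi => hxy i (by omega)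
      have h3 : ∀ z, birkhoff φ 1 z = φ z := fun z => by simp [birkhoff]
      rw [Nat.add_comm n 1, birkhoff_add, birkhoff_add, h3, h3, Nat.add_comm 1 n,
        Finset.sum_range_succ]
      linarith [(le_abs_self _).trans h2, le_abs_self (V (n + 2))]
  intro n x y hx hy hxy
  have := hsum.sum_le_tsum (Finset.range n) fun _ _ => abs_nonneg _
  linarith [key n x y hx hy hxy]

lemma BoundedDistortion.le_birkhoff_splice {M : ℕ → ℕ → Prop} {φ : Pt → ℝ} {D : ℝ}
    (hD : BoundedDistortion M φ D) {n : ℕ} {x y : Pt} (hx : isAdmissible M x)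
    (hy : isAdmissible M y) (h : x n = y 0) (m : ℕ) :
    birkhoff φ n x - D + birkhoff φ m y ≤ birkhoff φ (n + m) (splice n x y) := by
  rw [birkhoff_add, iterate_splice]
  have := hD n x (splice n x y) hx (hx.splice hy h) fun i hi => (splice_apply_of_le h hi).symm
  linarith

end Distortion

section Pressure

lemma sum_exp_birkhoff_le_Zn {M : ℕ → ℕ → Prop} {φ : Pt → ℝ} {a n : ℕ} (F : Finset Pt)
    (hF : ∀ x ∈ F, x ∈ PerSet M a n) :
    ENNReal.ofReal (∑ x ∈ F, Real.exp (birkhoff φ n x)) ≤ Zn M φ a n := by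
  rw [ENNReal.ofReal_sum_of_nonneg fun _ _ => (Real.exp_pos _).le, Zn,
    tsum_subtype (PerSet M a n) fun x => ENNReal.ofReal (Real.exp (birkhoff φ n x))]
  refine le_trans (Finset.sum_le_sum fun x hx => ?_) (ENNReal.sum_le_tsum F)
  rw [Set.indicator_of_mem (hF x hx)]

lemma eventually_Zn_le {M : ℕ → ℕ → Prop} {φ : Pt → ℝ} {a : ℕ}
    (hP : pressureAt M φ a = (0 : EReal)) {s : ℝ} (hs : 0 < s) :
    ∀ᶠ n : ℕ in atTop, Zn M φ a n ≤ ENNReal.ofReal (Real.exp (s * n)) := by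
  have h : pressureAt M φ a < (s : EReal) := by rw [hP]; exact_mod_cast hs
  filter_upwards [eventually_lt_of_limsup_lt h, eventually_gt_atTop 0] with n hn hn0
  have hn' : (0 : ℝ) < n := by exact_mod_cast hn0
  have hinv : (((n : ℝ) : EReal))⁻¹ = (((n : ℝ)⁻¹ : ℝ) : EReal) := (EReal.coe_inv _).symm
  rw [hinv] at hn
  have hlog : ENNReal.log (Zn M φ a n) ≤ ((s * n : ℝ) : EReal) := by
    generalize ENNReal.log (Zn M φ a n) = L at hn ⊢
    induction L with
    | bot => exact bot_le
    | top =>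
      rw [EReal.coe_mul_top_of_pos (inv_pos.2 hn')] at hn
      exact absurd hn (by simp)
    | coe r =>
      norm_cast at hn ⊢
      rw [inv_mul_lt_iff₀ hn'] at hn
      linarith
  have := EReal.exp_monotone hlog
  rwa [ENNReal.exp_log, EReal.exp_coe] at this

end Pressure

section Insertion

/-- Inserts into `y`, at time `t`, the first `k` symbols of `w`. -/
def insertLoop (t k : ℕ) (w y : Pt) : Pt := splice t y (splice k w (shiftMap^[t] y))

lemma iterate_insertLoop (t k : ℕ) (w y : Pt) :
    shiftMap^[k + t] (insertLoop t k w y) = shiftMap^[t] y := by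
  rw [Function.iterate_add_apply, insertLoop, iterate_splice, iterate_splice]

variable {M : ℕ → ℕ → Prop} {t k : ℕ} {w y : Pt}

lemma splice_iterate_zero (h0 : w 0 = y t) (hk : w k = y t) :
    splice k w (shiftMap^[t] y) 0 = y t := by
  rw [splice_apply_of_le (by simp [shiftMap_iterate_apply, hk]) k.zero_le, h0]

lemma insertLoop_apply_of_le (h0 : w 0 = y t) (hk : w k = y t) {i : ℕ} (hi : i ≤ t) :
    insertLoop t k w y i = y i :=
  splice_apply_of_le (splice_iterate_zero h0 hk).symm hi

lemma insertLoop_apply_succ (hk0 : 0 < k) (hk : w k = y t) :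
    insertLoop t k w y (t + 1) = w 1 := by
  rw [insertLoop, splice_apply_add,
    splice_apply_of_le (by simp [shiftMap_iterate_apply, hk]) hk0]

lemma isAdmissible.insertLoop (hw : isAdmissible M w) (hy : isAdmissible M y)
    (h0 : w 0 = y t) (hk : w k = y t) : isAdmissible M (insertLoop t k w y) :=
  hy.splice (hw.splice (hy.iterate t) (by simp [shiftMap_iterate_apply, hk]))
    (splice_iterate_zero h0 hk).symm

lemma BoundedDistortion.le_birkhoff_insertLoop {φ : Pt → ℝ} {D : ℝ}
    (hD : BoundedDistortion M φ D) (hw : isAdmissible M w) (hy : isAdmissible M y)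
    (h0 : w 0 = y t) (hk : w k = y t) {l : ℕ} (hl : t ≤ l) :
    birkhoff φ l y + (birkhoff φ k w - 2 * D) ≤ birkhoff φ (l + k) (CMS.insertLoop t k w y) := by
  obtain ⟨m, rfl⟩ := Nat.exists_eq_add_of_le hl
  have hk' : w k = shiftMap^[t] y 0 := by simp [shiftMap_iterate_apply, hk]
  have h1 := hD.le_birkhoff_splice hw (hy.iterate t) hk' m
  have h2 := hD.le_birkhoff_splice hy (hw.splice (hy.iterate t) hk')
    (splice_iterate_zero h0 hk).symm (k + m)
  rw [birkhoff_add, show t + m + k = t + (k + m) by ring, CMS.insertLoop]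
  linarith

lemma insertLoop_injective {y' : Pt} (hyy' : ∀ i ≤ t, y i = y' i)
    (h : insertLoop t k w y = insertLoop t k w y') : y = y' := by
  have h' := congrArg shiftMap^[k + t] h
  rw [iterate_insertLoop, iterate_insertLoop] at h'
  funext i
  rcases le_total i t with hi | hi
  · exact hyy' i hi
  · obtain ⟨j, rfl⟩ := Nat.exists_eq_add_of_le hi
    simpa [shiftMap_iterate_apply, Nat.add_comm] using congrFun h' j

/-- The words obtained from `x` by inserting, at visits to `a` in `[n - d, n)`, loops that
leave `a` along a different edge than `x` does. -/
lemma exists_insertions {φ : Pt → ℝ} {D C : ℝ} (hD : BoundedDistortion M φ D) {a K : ℕ}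
    (hloop : ∀ b : ℕ, ∃ (k : ℕ) (w : Pt), isAdmissible M w ∧ 0 < k ∧ k ≤ K ∧ w 0 = a ∧ w k = a ∧
      w 1 ≠ b ∧ -C ≤ birkhoff φ k w - 2 * D)
    {x : Pt} (hx : isAdmissible M x) (n d : ℕ) (hd : d ≤ n) :
    ∃ (F : Finset (Pt × ℕ)) (j : ℕ), j + Nat.count (fun i => x i = a) (n - d) =
        Nat.count (fun i => x i = a) n ∧
      (∀ p ∈ F, isAdmissible M p.1 ∧ (∀ i ≤ n - d, p.1 i = x i) ∧
        shiftMap^[p.2] p.1 = shiftMap^[n] x ∧ n ≤ p.2 ∧ p.2 ≤ n + d * K) ∧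
      (1 + Real.exp (-C)) ^ j * Real.exp (birkhoff φ n x) ≤
        ∑ p ∈ F, Real.exp (birkhoff φ p.2 p.1) := by
  classical
  induction d with
  | zero => exact ⟨{(x, n)}, 0, by simp, by simp [hx], by simp⟩
  | succ d ih =>
    obtain ⟨F, j, hj, hF, hsum⟩ := ih (by omega)
    obtain ⟨t, ht⟩ : ∃ t, n - (d + 1) = t := ⟨_, rfl⟩
    have ht' : n - d = t + 1 := by omega
    rw [ht'] at hj hF
    rw [ht]
    rw [Nat.count_succ] at hj
    by_cases hxt : x t = a
    swap
    · refine ⟨F, j, by simpa [hxt] using hj, fun p hp => ?_, hsum⟩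
      obtain ⟨h1, h2, h3, h4, h5⟩ := hF p hp
      exact ⟨h1, fun i hi => h2 i (by omega), h3, h4, by rw [Nat.succ_mul]; omega⟩
    obtain ⟨k, w, hw, hk0, hkK, hw0, hwk, hw1, hwC⟩ := hloop (x (t + 1))
    have hpt : ∀ p ∈ F, p.1 t = a := fun p hp => by rw [(hF p hp).2.1 t (by omega), hxt]
    let g : Pt × ℕ → Pt × ℕ := fun p => (insertLoop t k w p.1, p.2 + k)
    have hg : Set.InjOn g F := by
      intro p hp p' hp' h
      simp only [g, Prod.mk.injEq] at h
      refine Prod.ext (insertLoop_injective (fun i hi => ?_) h.1) (by omega)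
      rw [(hF p hp).2.1 i (by omega), (hF p' hp').2.1 i (by omega)]
    have hdisj : Disjoint F (F.image g) := by
      rw [Finset.disjoint_left]
      intro p hp hp'
      obtain ⟨p', hpF, rfl⟩ := Finset.mem_image.1 hp'
      have h := (hF _ hp).2.1 (t + 1) le_rfl
      exact hw1 ((insertLoop_apply_succ hk0 (by rw [hwk, hpt p' hpF])).symm.trans h)
    refine ⟨F ∪ F.image g, j + 1, by simp only [hxt, if_true] at hj; omega, fun p hp => ?_, ?_⟩
    · rcases Finset.mem_union.1 hp with hp | hp
      · obtain ⟨h1, h2, h3, h4, h5⟩ := hF p hp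
        exact ⟨h1, fun i hi => h2 i (by omega), h3, h4, by rw [Nat.succ_mul]; omega⟩
      · obtain ⟨p, hpF, rfl⟩ := Finset.mem_image.1 hp
        obtain ⟨h1, h2, h3, h4, h5⟩ := hF p hpF
        have h0 : w 0 = p.1 t := by rw [hw0, hpt p hpF]
        have hk : w k = p.1 t := by rw [hwk, hpt p hpF]
        refine ⟨hw.insertLoop h1 h0 hk, fun i hi => ?_, ?_, by simp only [g]; omega,
          by simp only [g]; rw [Nat.succ_mul]; omega⟩
        · simp only [g]
          rw [insertLoop_apply_of_le h0 hk hi, h2 i (by omega)]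
        · obtain ⟨m, hm⟩ := Nat.exists_eq_add_of_le (show t ≤ p.2 by omega)
          simp only [g]
          rw [← h3, show p.2 + k = m + (k + t) by omega, Function.iterate_add_apply,
            iterate_insertLoop, ← Function.iterate_add_apply, hm, Nat.add_comm]
    · rw [Finset.sum_union hdisj, Finset.sum_image hg, pow_succ]
      have hle : Real.exp (-C) * ∑ p ∈ F, Real.exp (birkhoff φ p.2 p.1) ≤
          ∑ p ∈ F, Real.exp (birkhoff φ (g p).2 (g p).1) := by
        rw [Finset.mul_sum]
        refine Finset.sum_le_sum fun p hp => ?_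
        rw [← Real.exp_add, Real.exp_le_exp]
        have := hD.le_birkhoff_insertLoop hw (hF p hp).1 (t := t) (k := k) (l := p.2)
          (by rw [hw0, hpt p hp]) (by rw [hwk, hpt p hp]) (by have := (hF p hp).2.2.2.1; omega)
        simp only [g]
        linarith
      have := mul_le_mul_of_nonneg_left hsum (show 0 ≤ 1 + Real.exp (-C) by positivity)
      linarith

end Insertion

section Visits

/-- If `a` has two distinct outgoing edges, the Birkhoff sum along a periodic orbit is at most
a negative multiple of its number of visits to `a`. -/
lemma birkhoff_le_of_loops {M : ℕ → ℕ → Prop} {φ : Pt → ℝ} {D C : ℝ}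
    (hD : BoundedDistortion M φ D) (hP : ∀ b : ℕ, pressureAt M φ b = (0 : EReal)) {a K : ℕ}
    (hloop : ∀ b : ℕ, ∃ (k : ℕ) (w : Pt), isAdmissible M w ∧ 0 < k ∧ k ≤ K ∧ w 0 = a ∧ w k = a ∧
      w 1 ≠ b ∧ -C ≤ birkhoff φ k w - 2 * D)
    {x : Pt} (hx : isAdmissible M x) {n : ℕ} (hn : 0 < n) (hper : shiftMap^[n] x = x) :
    birkhoff φ n x ≤ -(Real.log (1 + Real.exp (-C)) * Nat.count (fun i => x i = a) n) := by
  classical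
  set m := Nat.count (fun i => x i = a) n with hm
  set A : ℝ := Real.log (1 + Real.exp (-C)) * m + birkhoff φ n x with hA
  set B : ℝ := 2 * (n * (1 + K)) with hB
  have hBpos : 0 < B := by positivity
  suffices h : ∀ s : ℝ, 0 < s → s ≤ 1 → A ≤ s * B by
    by_contra hcon
    have hApos : 0 < A := by rw [hA]; linarith
    have h1 := h (min 1 (A / (2 * B))) (by positivity) (min_le_left _ _)
    have h2 : min 1 (A / (2 * B)) * B ≤ A / (2 * B) * B := by gcongr; exact min_le_right _ _
    have h3 : A / (2 * B) * B = A / 2 := by field_simp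
    linarith
  intro s hs hs1
  obtain ⟨N, hN⟩ := eventually_atTop.1 (eventually_Zn_le (hP (x 0)) hs)
  have key : ∀ k : ℕ, N + 1 ≤ k → k * A ≤ (D - Real.log s) + k * (s * B) := by
    intro k hk
    obtain ⟨F, j, hj, hF, hsum⟩ := exists_insertions hD hloop hx (k * n) (k * n) le_rfl
    rw [Nat.sub_self, Nat.count_zero, Nat.add_zero,
      count_mul_of_periodic hper (fun b => b = a), ← hm] at hj
    rw [iterate_mul_of_periodic hper] at hF
    have hkn : N + 1 ≤ k * n := hk.trans (Nat.le_mul_of_pos_right k hn)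
    set U := k * n + k * n * K with hU
    have hfiber : ∀ l ∈ Finset.Icc (k * n) U,
        ∑ p ∈ F with p.2 = l, Real.exp (birkhoff φ p.2 p.1) ≤
          Real.exp D * Real.exp (s * U) := by
      intro l hl
      rw [Finset.mem_Icc] at hl
      have hprop : ∀ p ∈ F.filter (fun p => p.2 = l), isAdmissible M p.1 ∧ p.1 0 = x 0 ∧
          shiftMap^[l] p.1 = x ∧ p.1 l = p.1 0 ∧ p.2 = l := by
        intro p hp
        obtain ⟨hpF, rfl⟩ := Finset.mem_filter.1 hp
        obtain ⟨h1, h2, h3, -, -⟩ := hF p hpF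
        have h0 := h2 0 (Nat.zero_le _)
        refine ⟨h1, h0, h3, ?_, rfl⟩
        rw [h0, ← congrFun h3 0, shiftMap_iterate_apply, Nat.zero_add]
      have hinj : Set.InjOn (fun p : Pt × ℕ => perClosure l p.1) (F.filter (fun p => p.2 = l)) := by
        intro p hp p' hp' h
        obtain ⟨-, -, h3, h4, h5⟩ := hprop p hp
        obtain ⟨-, -, h3', h4', h5'⟩ := hprop p' hp'
        refine Prod.ext (funext fun i => ?_) (h5.trans h5'.symm)
        rcases le_total i l with hi | hi
        · rw [← perClosure_apply_of_le h4 hi, ← perClosure_apply_of_le h4' hi]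
          exact congrFun h i
        · obtain ⟨i, rfl⟩ := Nat.exists_eq_add_of_le hi
          rw [Nat.add_comm, ← shiftMap_iterate_apply l p.1, ← shiftMap_iterate_apply l p'.1, h3, h3']
      have hZ := (sum_exp_birkhoff_le_Zn (φ := φ) (M := M) (a := x 0) (n := l)
        ((F.filter (fun p => p.2 = l)).image fun p => perClosure l p.1) (by
          intro y hy
          obtain ⟨p, hp, rfl⟩ := Finset.mem_image.1 hy
          obtain ⟨h1, h2, -, h4, -⟩ := hprop p hp
          refine ⟨h1.perClosure (by omega) h4, iterate_perClosure _ _, ?_⟩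
          rw [perClosure_apply_of_le h4 (Nat.zero_le _), h2])).trans (hN l (by omega))
      rw [ENNReal.ofReal_le_ofReal_iff (Real.exp_pos _).le, Finset.sum_image hinj] at hZ
      calc ∑ p ∈ F with p.2 = l, Real.exp (birkhoff φ p.2 p.1)
          ≤ ∑ p ∈ F with p.2 = l, Real.exp D * Real.exp (birkhoff φ l (perClosure l p.1)) := by
            refine Finset.sum_le_sum fun p hp => ?_
            obtain ⟨h1, -, -, h4, h5⟩ := hprop p hp
            rw [← Real.exp_add, Real.exp_le_exp, h5, add_comm]
            exact hD l _ _ h1 (h1.perClosure (by omega) h4) fun i hi =>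
              (perClosure_apply_of_le h4 hi).symm
        _ = Real.exp D * ∑ p ∈ F with p.2 = l, Real.exp (birkhoff φ l (perClosure l p.1)) := by
            rw [Finset.mul_sum]
        _ ≤ Real.exp D * Real.exp (s * U) := by
            refine mul_le_mul_of_nonneg_left (hZ.trans ?_) (Real.exp_pos _).le
            rw [Real.exp_le_exp]
            have : (l : ℝ) ≤ U := by exact_mod_cast hl.2
            gcongr
    have hmaps : ∀ p ∈ F, p.2 ∈ Finset.Icc (k * n) U := fun p hp =>
      Finset.mem_Icc.2 (hF p hp).2.2.2
    rw [← Finset.sum_fiberwise_of_maps_to hmaps] at hsum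
    have h1 := hsum.trans (Finset.sum_le_card_nsmul _ _ _ hfiber)
    have hcard : ((Finset.Icc (k * n) U).card : ℝ) ≤ Real.exp (s * U) / s := by
      rw [le_div_iff₀ hs]
      have h2 : (Finset.Icc (k * n) U).card ≤ U + 1 := by rw [Nat.card_Icc]; omega
      have h3 : ((Finset.Icc (k * n) U).card : ℝ) ≤ U + 1 := by exact_mod_cast h2
      nlinarith [Real.add_one_le_exp (s * U)]
    have h4 : (1 + Real.exp (-C)) ^ j * Real.exp (birkhoff φ (k * n) x) ≤
        Real.exp (D - Real.log s + s * U + s * U) := by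
      refine h1.trans ?_
      rw [nsmul_eq_mul, Real.exp_add, Real.exp_add, Real.exp_sub, Real.exp_log hs]
      calc _ ≤ Real.exp (s * U) / s * (Real.exp D * Real.exp (s * U)) := by gcongr
        _ = _ := by ring
    have h5 := Real.log_le_log (by positivity) h4
    rw [Real.log_exp, Real.log_mul (by positivity) (by positivity), Real.log_pow, Real.log_exp,
      birkhoff_mul_of_periodic φ hper, hj] at h5
    rw [hA, hB]
    rw [hU] at h5
    push_cast at h5
    linarith
  by_contra hcon
  push Not at hcon
  obtain ⟨k, hk⟩ := exists_nat_gt ((D - Real.log s) / (A - s * B))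
  have hk' := (div_lt_iff₀ (sub_pos.2 hcon)).1 hk
  have h1 := key (k + (N + 1)) (by omega)
  have h2 : (0 : ℝ) ≤ ((N + 1 : ℕ) : ℝ) * (A - s * B) :=
    mul_nonneg (Nat.cast_nonneg _) (sub_pos.2 hcon).le
  push_cast at h1 h2
  nlinarith

/-- In a transitive shift on an infinite alphabet, every state leads deterministically to a state
with two distinct outgoing edges. -/
lemma exists_branching {M : ℕ → ℕ → Prop} (htrans : TopTransitive M) (a : ℕ) :
    ∃ (r : ℕ) (x y : Pt), isAdmissible M x ∧ isAdmissible M y ∧ x 0 = y 0 ∧ x 1 ≠ y 1 ∧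
      ∀ z, isAdmissible M z → z 0 = a → z r = x 0 := by
  classical
  by_cases h : ∃ r, ∃ x y : Pt, isAdmissible M x ∧ isAdmissible M y ∧ x 0 = a ∧ y 0 = a ∧
      x r ≠ y r
  · obtain ⟨x, y, hx, hy, hx0, hy0, hxy⟩ := Nat.find_spec h
    have hmin : ∀ r < Nat.find h, ∀ z z' : Pt, isAdmissible M z → isAdmissible M z' →
        z 0 = a → z' 0 = a → z r = z' r := fun r hr z z' hz hz' hz0 hz0' => by
      by_contra hne
      exact Nat.find_min h hr ⟨z, z', hz, hz', hz0, hz0', hne⟩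
    generalize Nat.find h = R at hmin hxy
    obtain _ | r := R
    · exact absurd (hx0.trans hy0.symm) hxy
    refine ⟨r, shiftMap^[r] x, shiftMap^[r] y, hx.iterate r, hy.iterate r, ?_, ?_, ?_⟩
    · simpa [shiftMap_iterate_apply] using hmin r r.lt_succ_self x y hx hy hx0 hy0
    · simpa [shiftMap_iterate_apply, Nat.add_comm] using hxy
    · intro z hz hz0
      simpa [shiftMap_iterate_apply] using hmin r r.lt_succ_self z x hz hx hz0 hx0
  · exfalso
    push Not at h
    obtain ⟨N, x, hx, hx0, hxN⟩ := htrans a (a + 1)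
    obtain ⟨L, y, hy, hy0, hyL⟩ := htrans (a + 1) a
    have hN : N ≠ 0 := by rintro rfl; omega
    have hz := hx.splice hy (hxN.trans hy0.symm)
    have hz0 : splice N x y 0 = a := by
      rw [splice_apply_of_le (hxN.trans hy0.symm) (Nat.zero_le _), hx0]
    have hzr : splice N x y (N + L) = a := by rw [splice_apply_add, hyL]
    generalize splice N x y = z at hz hz0 hzr
    have hp : ∀ i, z (i + (N + L)) = z i := fun i => by
      rw [← shiftMap_iterate_apply (N + L) z]
      refine h i _ z (hz.iterate _) hz ?_ hz0
      rw [shiftMap_iterate_apply, Nat.zero_add, hzr]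
    have hfin : (Set.range z).Finite := by
      refine ((Finset.range (N + L)).finite_toSet.image z).subset ?_
      rintro _ ⟨i, rfl⟩
      refine ⟨i % (N + L), by simpa using Nat.mod_lt i (by omega), ?_⟩
      exact Function.Periodic.map_mod_nat hp i
    refine Set.infinite_univ (hfin.subset fun b _ => ?_)
    obtain ⟨i, u, hu, hu0, hui⟩ := htrans a b
    exact ⟨i, by rw [← hui]; exact h i z u hz hu hz0 hu0⟩

lemma exists_loop_through {M : ℕ → ℕ → Prop} (htrans : TopTransitive M) {x : Pt}
    (hx : isAdmissible M x) :
    ∃ (k : ℕ) (w : Pt), isAdmissible M w ∧ 0 < k ∧ w 0 = x 0 ∧ w k = x 0 ∧ w 1 = x 1 := by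
  obtain ⟨L, y, hy, hy0, hyL⟩ := htrans (x 1) (x 0)
  refine ⟨1 + L, splice 1 x y, hx.splice hy hy0.symm, by omega, ?_, ?_, ?_⟩
  · rw [splice_apply_of_le hy0.symm (Nat.zero_le _)]
  · rw [splice_apply_add, hyL]
  · rw [splice_apply_of_le hy0.symm le_rfl]

lemma exists_birkhoff_le_count {M : ℕ → ℕ → Prop} {φ : Pt → ℝ} {D : ℝ}
    (htrans : TopTransitive M) (hD : BoundedDistortion M φ D)
    (hP : ∀ b : ℕ, pressureAt M φ b = (0 : EReal)) (a : ℕ) :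
    ∃ c : ℝ, 0 < c ∧ ∀ (x : Pt) (n : ℕ), isAdmissible M x → 0 < n → shiftMap^[n] x = x →
      birkhoff φ n x ≤ -(c * Nat.count (fun i => x i = a) n) := by
  classical
  obtain ⟨r, y, y', hy, hy', h0, h1, hr⟩ := exists_branching htrans a
  obtain ⟨k, w, hw, hk, hw0, hwk, hw1⟩ := exists_loop_through htrans hy
  obtain ⟨k', w', hw', hk', hw0', hwk', hw1'⟩ := exists_loop_through htrans hy'
  set C := max (-(birkhoff φ k w - 2 * D)) (-(birkhoff φ k' w' - 2 * D)) with hC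
  refine ⟨Real.log (1 + Real.exp (-C)), Real.log_pos (by linarith [Real.exp_pos (-C)]),
    fun x n hx hn hper => ?_⟩
  have hb := birkhoff_le_of_loops (C := C) (a := y 0) (K := max k k') hD hP (fun b => by
    by_cases hb : y 1 = b
    · refine ⟨k', w', hw', hk', le_max_right _ _, by rw [hw0', h0], by rw [hwk', h0], ?_, ?_⟩
      · rw [hw1', ← hb]; exact h1.symm
      · linarith [le_max_right (-(birkhoff φ k w - 2 * D)) (-(birkhoff φ k' w' - 2 * D))]
    · refine ⟨k, w, hw, hk, le_max_left _ _, hw0, hwk, by rwa [hw1], ?_⟩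
      linarith [le_max_left (-(birkhoff φ k w - 2 * D)) (-(birkhoff φ k' w' - 2 * D))])
    hx hn hper
  refine hb.trans (neg_le_neg ?_)
  have hcount : Nat.count (fun i => x i = a) n ≤ Nat.count (fun i => x i = y 0) n := by
    have hpp : Function.Periodic (fun i => x i = y 0) n := fun i => by
      simp only [← shiftMap_iterate_apply, hper]
    have h2 : Nat.count (fun i => x i = a) n ≤ Nat.count (fun i => x (r + i) = y 0) n := by
      refine Nat.count_mono_left fun i _ hi => ?_
      have := hr (shiftMap^[i] x) (hx.iterate i) (by simpa [shiftMap_iterate_apply] using hi)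
      rwa [shiftMap_iterate_apply] at this
    have h3 := Nat.count_add (fun i => x i = y 0) r n
    have h4 := Nat.count_add (fun i => x i = y 0) n r
    have h5 : ∀ i, (x (n + i) = y 0) = (x i = y 0) := fun i => by
      rw [Nat.add_comm]; exact hpp i
    simp only [h5] at h4
    rw [Nat.add_comm n r] at h4
    omega
  have hlog : 0 ≤ Real.log (1 + Real.exp (-C)) := Real.log_nonneg (by linarith [Real.exp_pos (-C)])
  gcongr

end Visits

section Infinity

lemma exists_of_deltaInf_neg {M : ℕ → ℕ → Prop} {φ : Pt → ℝ}
    (hCI : deltaInf M φ < (0 : EReal)) :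
    ∃ (q M' N : ℕ) (ε : ℝ), 0 < M' ∧ 0 < ε ∧ ∀ n, N ≤ n → ∀ x, inBSet M n M' q x →
      birkhoff φ n x ≤ -(ε * n) := by
  obtain ⟨q, hq⟩ := (frequently_lt_of_liminf_lt (by isBoundedDefault) hCI).exists
  obtain ⟨M', hM', hM'0⟩ := ((frequently_lt_of_liminf_lt (by isBoundedDefault) hq).and_eventually
    (eventually_gt_atTop 0)).exists
  obtain ⟨e, he, he0⟩ := EReal.lt_iff_exists_real_btwn.1 hM'
  obtain ⟨N, hN⟩ := eventually_atTop.1 (eventually_lt_of_limsup_lt he)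
  refine ⟨q, M', N + 1, -e, hM'0, by simpa using he0, fun n hn x hx => ?_⟩
  have h1 := (le_iSup (fun x : {x : Pt // inBSet M n M' q x} =>
    ((birkhoff φ n x.1 / (n : ℝ) : ℝ) : EReal)) ⟨x, hx⟩).trans (hN n (by omega)).le
  have h2 : birkhoff φ n x / n ≤ e := by exact_mod_cast h1
  have hn0 : (0 : ℝ) < n := by exact_mod_cast (show 0 < n by omega)
  rw [div_le_iff₀ hn0] at h2
  linarith

/-- Periodic orbits that rarely visit `{0, …, q}` inherit the contraction at infinity. -/
lemma birkhoff_le_of_rare {M : ℕ → ℕ → Prop} {φ : Pt → ℝ} {D ε : ℝ} {q M' N : ℕ}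
    (htrans : TopTransitive M) (hD : BoundedDistortion M φ D) (hM' : 0 < M')
    (hinf : ∀ n, N ≤ n → ∀ x, inBSet M n M' q x → birkhoff φ n x ≤ -(ε * n))
    {x : Pt} (hx : isAdmissible M x) {n : ℕ} (hn : 0 < n) (hper : shiftMap^[n] x = x)
    (hrare : Nat.count (fun i => x i ≤ q) n * M' < n) :
    birkhoff φ n x ≤ -(ε * n) := by
  obtain ⟨p, u, hu, hu0, hup⟩ := htrans 0 (x 0)
  obtain ⟨r, v, hv, hv0, hvr⟩ := htrans (x 0) 0
  set c := Nat.count (fun i => x i ≤ q) n with hc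
  set E : ℝ := 2 * D - birkhoff φ p u - birkhoff φ r v - ε * (p + r) with hE
  have key : ∀ k : ℕ, N + (p + r + 1) * M' ≤ k → k * (birkhoff φ n x + ε * n) ≤ E := by
    intro k hk
    have hxk : x (k * n) = v 0 := by
      rw [hv0, ← Nat.zero_add (k * n), ← shiftMap_iterate_apply (k * n) x, iterate_mul_of_periodic hper]
    have hin0 : splice (k * n) x v 0 = x 0 := splice_apply_of_le hxk (Nat.zero_le _)
    have hup' : u p = splice (k * n) x v 0 := hup.trans hin0.symm
    have hxv := hx.splice hv hxk
    set y := splice p u (splice (k * n) x v) with hy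
    have hyv : ∀ i, y (p + (k * n + i)) = v i := fun i => by
      rw [hy, splice_apply_add, splice_apply_add]
    have hcount : Nat.count (fun i => y i ≤ q) (p + (k * n + (r + 1))) ≤ p + k * c + (r + 1) := by
      rw [Nat.count_add, Nat.count_add]
      have h1 : Nat.count (fun i => y i ≤ q) p ≤ p := Nat.count_le _
      have h2 : Nat.count (fun i => y (p + (k * n + i)) ≤ q) (r + 1) ≤ r + 1 := Nat.count_le _
      have h3 : Nat.count (fun i => y (p + i) ≤ q) (k * n) ≤ k * c := by
        rw [hc, ← count_mul_of_periodic hper (fun b => b ≤ q)]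
        refine Nat.count_mono_left fun i hi h => ?_
        rwa [hy, splice_apply_add, splice_apply_of_le hxk hi.le] at h
      omega
    have hmem : inBSet M (p + (k * n + r)) M' q y := by
      refine ⟨hu.splice hxv hup', ?_, ?_, ?_⟩
      · rw [hy, splice_apply_of_le hup' (Nat.zero_le _), hu0]
        exact Nat.zero_le _
      · rw [hyv, hvr]
        exact Nat.zero_le _
      · rw [← Nat.count_eq_card_filter_range, le_div_iff₀ (by exact_mod_cast hM')]
        have h1 : (p + k * c + (r + 1)) * M' ≤ p + (k * n + (r + 1)) := by
          have : k * (c * M' + 1) ≤ k * n := Nat.mul_le_mul_left k hrare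
          nlinarith
        have h2 := (Nat.mul_le_mul_right M' hcount).trans h1
        exact_mod_cast h2
    have hle : N ≤ p + (k * n + r) := by
      have : k ≤ k * n := Nat.le_mul_of_pos_right k hn
      omega
    have h1 := hinf _ hle y hmem
    have h2 := hD.le_birkhoff_splice hu hxv hup' (k * n + r)
    have h3 := hD.le_birkhoff_splice hx hv hxk r
    rw [birkhoff_mul_of_periodic φ hper] at h3
    push_cast at h1
    rw [hE]
    linarith
  by_contra hcon
  have hpos : 0 < birkhoff φ n x + ε * n := by linarith
  obtain ⟨k, hk⟩ := exists_nat_gt (E / (birkhoff φ n x + ε * n))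
  rw [div_lt_iff₀ hpos] at hk
  have h1 := key (k + (N + (p + r + 1) * M')) (by omega)
  have h2 : (0 : ℝ) ≤ ((N + (p + r + 1) * M' : ℕ) : ℝ) * (birkhoff φ n x + ε * n) :=
    mul_nonneg (Nat.cast_nonneg _) hpos.le
  rw [Nat.cast_add, add_mul] at h1
  linarith

lemma count_le_eq_sum (x : Pt) (q n : ℕ) :
    Nat.count (fun i => x i ≤ q) n =
      ∑ a ∈ Finset.range (q + 1), Nat.count (fun i => x i = a) n := by
  induction n with
  | zero => simp
  | succ n ih =>
    simp only [Nat.count_succ, Finset.sum_add_distrib, ih]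
    congr 1
    simp

end Infinity

end CMS

open CMS

/-- Proposition `prop:CI-UCS`.
For a topologically transitive countable Markov shift with the F-property and a
potential `φ` with summable variations and Gurevich pressure `P(φ) = 0`:
if `δ_{φ,∞} < 0` (condition (CI)) then `χ_per(φ) < 0` (condition (UCS)). -/
theorem CI_implies_UCS
    (M : ℕ → ℕ → Prop) (φ : Pt → ℝ)
    (htrans : TopTransitive M) (hF : FProperty M)
    (hsum : SummableVariations M φ)
    (hP : ∀ a : ℕ, pressureAt M φ a = (0 : EReal))
    (hCI : deltaInf M φ < (0 : EReal)) :
    chiPer M φ < (0 : EReal) := by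
  obtain ⟨D, hD⟩ := hsum.exists_boundedDistortion
  obtain ⟨q, M', N, ε, hM', hε, hinf⟩ := exists_of_deltaInf_neg hCI
  choose c hc hcount using exists_birkhoff_le_count htrans hD hP
  obtain ⟨a₀, -, ha₀⟩ := Finset.exists_min_image (Finset.range (q + 1)) c ⟨0, by simp⟩
  have hM'pos : (0 : ℝ) < M' := by exact_mod_cast hM'
  set η : ℝ := min ε (c a₀ / ((q + 1) * M')) with hη
  have hηpos : 0 < η := lt_min hε (div_pos (hc a₀) (by positivity))
  have hbound : chiPer M φ ≤ ((-η : ℝ) : EReal) := by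
    refine iSup_le ?_
    rintro ⟨⟨x, n⟩, hx, hn, hper⟩
    rw [EReal.coe_le_coe_iff]
    simp only at hx hn hper ⊢
    have hn' : (0 : ℝ) < n := by exact_mod_cast hn
    rw [div_le_iff₀ hn']
    rcases lt_or_ge (Nat.count (fun i => x i ≤ q) n * M') n with hrare | hfreq
    · have h1 := birkhoff_le_of_rare htrans hD hM' hinf hx hn hper hrare
      have h2 : η * n ≤ ε * n := by gcongr; exact min_le_left _ _
      linarith
    · have h1 : ∑ a ∈ Finset.range (q + 1), c a₀ * (Nat.count (fun i => x i = a) n : ℝ) ≤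
          ∑ _a ∈ Finset.range (q + 1), -birkhoff φ n x := by
        refine Finset.sum_le_sum fun a ha => ?_
        have h2 := hcount a x n hx hn hper
        have h3 : c a₀ * (Nat.count (fun i => x i = a) n : ℝ) ≤
            c a * (Nat.count (fun i => x i = a) n : ℝ) := by
          gcongr
          exact ha₀ a ha
        linarith
      rw [← Finset.mul_sum, ← Nat.cast_sum, ← count_le_eq_sum, Finset.sum_const,
        Finset.card_range, nsmul_eq_mul] at h1
      push_cast at h1
      have h4 : (n : ℝ) ≤ Nat.count (fun i => x i ≤ q) n * M' := by exact_mod_cast hfreq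
      have h5 : η * n ≤ c a₀ / ((q + 1) * M') * n := by gcongr; exact min_le_right _ _
      have h6 : c a₀ / ((q + 1) * M') * n ≤ -birkhoff φ n x := by
        rw [div_mul_eq_mul_div, div_le_iff₀ (by positivity)]
        have h7 := mul_le_mul_of_nonneg_left h4 (hc a₀).le
        have h8 := mul_le_mul_of_nonneg_right h1 hM'pos.le
        linarith
      linarith
  refine hbound.trans_lt ?_
  exact_mod_cast neg_lt_zero.2 hηpos
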